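/- arXiv:2108.02630 — 2 statements merged into one kernel-verified Lean document; each statement's English description precedes it below -/
import Mathlib

section
/- Let t and k be integers with k ≥ 4 and t ≥ k+1, and let G be a spanning subgraph of the complete bipartite graph K_{t,t} with bipartition (X,Y) containing a cycle C of length 2k. Let x ∈ X and y ∈ Y be vertices not on C with xy ∈ E(G). If each of x and y is adjacent in G to at least ⌈k/2⌉+1 vertices of C, then G contains a cycle of length 2k+2. -/
open SimpleGraph Sum

/-- The complete bipartite graph `K_{t,t}` with both parts a copy of `Fin t`. -/
abbrev Kbb (t : ℕ) : SimpleGraph (Fin t ⊕ Fin t) := completeBipartiteGraph (Fin t) (Fin t)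

/-- `G` contains a cycle of length `m`. -/
def HasCycleLen {V : Type*} (G : SimpleGraph V) (m : ℕ) : Prop :=
  ∃ (v : V) (w : G.Walk v v), w.IsCycle ∧ w.length = m

/-- Every subgraph `G` of `K_{b,b}` contains a cycle of length `m`, or its bipartite
complement in `K_{b,b}` contains a cycle of length `n`. -/
def BRprop (m n b : ℕ) : Prop :=
  ∀ G : SimpleGraph (Fin b ⊕ Fin b), G ≤ Kbb b →
    HasCycleLen G m ∨ HasCycleLen (Kbb b \ G) n

theorem SimpleGraph.exists_isPath_of_injOn {V : Type*} {G : SimpleGraph V} (f : ℕ → V) (n : ℕ)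
    (hf : Set.InjOn f (Set.Iic n)) (hadj : ∀ i < n, G.Adj (f i) (f (i + 1))) :
    ∃ p : G.Walk (f 0) (f n), p.IsPath ∧ p.length = n ∧ ∀ v ∈ p.support, ∃ i ≤ n, f i = v := by
  induction n with
  | zero => exact ⟨.nil, by simp, by simp, by simp⟩
  | succ n ih =>
    obtain ⟨p, hp, hlen, hsupp⟩ :=
      ih (hf.mono (Set.Iic_subset_Iic.2 n.le_succ)) fun i hi => hadj i (by omega)
    refine ⟨p.concat (hadj n n.lt_succ_self), hp.concat (fun hmem => ?_) _, by simp [hlen], ?_⟩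
    · obtain ⟨i, hi, hfi⟩ := hsupp _ hmem
      have := hf (Set.mem_Iic.2 (by omega)) (Set.mem_Iic.2 le_rfl) hfi
      omega
    · intro v hv
      rw [Walk.support_concat, List.mem_append, List.mem_singleton] at hv
      rcases hv with hv | rfl
      · obtain ⟨i, hi, rfl⟩ := hsupp v hv
        exact ⟨i, by omega, rfl⟩
      · exact ⟨n + 1, le_rfl, rfl⟩

theorem hasCycleLen_of_injOn {V : Type*} {G : SimpleGraph V} (f : ℕ → V) {n : ℕ} (hn : 2 ≤ n)
    (hf : Set.InjOn f (Set.Iic n)) (hadj : ∀ i < n, G.Adj (f i) (f (i + 1)))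
    (hclose : G.Adj (f n) (f 0)) : HasCycleLen G (n + 1) := by
  obtain ⟨p, hp, hlen, -⟩ := exists_isPath_of_injOn f n hf hadj
  refine ⟨_, .cons hclose p, ?_, by simp [hlen]⟩
  refine (Walk.cons_isCycle_iff p hclose).2 ⟨hp, fun hmem => ?_⟩
  rw [Sym2.eq_swap] at hmem
  have := hp.length_eq_one_of_mem_edges hmem
  omega

/-- An alternating closed sequence `Y 0, X 0, Y 1, X 1, …, Y k, X k` is a cycle. -/
theorem hasCycleLen_of_alternating {α β : Type*} {G : SimpleGraph (α ⊕ β)} {k : ℕ} (hk : 1 ≤ k)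
    (X : ℕ → α) (Y : ℕ → β) (hX : Set.InjOn X (Set.Iic k)) (hY : Set.InjOn Y (Set.Iic k))
    (hYX : ∀ i ≤ k, G.Adj (inr (Y i)) (inl (X i)))
    (hXY : ∀ i < k, G.Adj (inl (X i)) (inr (Y (i + 1))))
    (hclose : G.Adj (inl (X k)) (inr (Y 0))) : HasCycleLen G (2 * k + 2) := by
  refine hasCycleLen_of_injOn (n := 2 * k + 1)
    (fun i => if i % 2 = 0 then inr (Y (i / 2)) else inl (X (i / 2))) (by omega) ?_ ?_ ?_
  · intro a ha b hb hab
    simp only [Set.mem_Iic] at ha hb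
    have ha' : a / 2 ∈ Set.Iic k := Set.mem_Iic.2 (by omega)
    have hb' : b / 2 ∈ Set.Iic k := Set.mem_Iic.2 (by omega)
    dsimp only at hab
    split_ifs at hab
    · have := hY ha' hb' (inr_injective hab)
      omega
    · have := hX ha' hb' (inl_injective hab)
      omega
  · intro i hi
    rcases Nat.even_or_odd' i with ⟨m, rfl | rfl⟩
    · have h : (2 * m + 1) / 2 = m := by omega
      simpa [h, Nat.add_mod] using hYX m (by omega)
    · have h : (2 * m + 1) / 2 = m := by omega
      have h' : (2 * m + 1 + 1) / 2 = m + 1 := by omega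
      have h2 : (2 * m + 1 + 1) % 2 = 0 := by omega
      simpa [h, h', h2, Nat.add_mod] using hXY m (by omega)
  · have h : (2 * k + 1) / 2 = k := by omega
    simpa [h, Nat.add_mod] using hclose

theorem injOn_ite_mod {α : Type*} {k : ℕ} (hk : 0 < k) (u : Fin k → α) (hu : Function.Injective u)
    {a : α} (ha : a ∉ Set.range u) (c : ℕ) :
    Set.InjOn (fun i => if i < k then u ⟨(c + i) % k, Nat.mod_lt _ hk⟩ else a) (Set.Iic k) := by
  intro i hi j hj hij
  simp only [Set.mem_Iic] at hi hj
  dsimp only at hij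
  split_ifs at hij with h h' h'
  · have hmod : i ≡ j [MOD k] := Nat.ModEq.add_left_cancel' c (Fin.mk.inj (hu hij))
    exact hmod.eq_of_lt_of_lt h h'
  · exact absurd ⟨_, hij⟩ ha
  · exact absurd ⟨_, hij.symm⟩ ha
  · omega

/-- Two sets of indices with more than `k` elements in total share an index. -/
theorem exists_mem_inter_of_lt_ncard_add {k : ℕ} (A B : Set (Fin k))
    (h : k < A.ncard + B.ncard) : ∃ j, j ∈ A ∧ j ∈ B := by
  by_contra! hdisj
  have hle := Set.ncard_le_card (A ∪ B)
  rw [Set.ncard_union_eq (Set.disjoint_left.2 hdisj), Nat.card_fin] at hle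
  omega

/-- Lemma 2 (second case): if `G ⊆ K_{t,t}` (`k ≥ 4`, `t ≥ k+1`) has a `2k`-cycle and
`x ∈ X`, `y ∈ Y` are off the cycle with `xy ∈ E(G)`, each adjacent to at least
`⌈k/2⌉ + 1` vertices of the cycle, then `G` has a cycle of length `2k + 2`. -/
theorem stmt3 (t k : ℕ) (hk : 4 ≤ k) (ht : k + 1 ≤ t)
    (G : SimpleGraph (Fin t ⊕ Fin t)) (hG : G ≤ Kbb t)
    (xs ys : Fin k → Fin t) (hxs : Function.Injective xs) (hys : Function.Injective ys)
    (hC : ∀ j : Fin k,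
      G.Adj (inl (xs j)) (inr (ys j)) ∧
      G.Adj (inr (ys j)) (inl (xs ⟨(j.val + 1) % k, Nat.mod_lt _ (by omega)⟩)))
    (x y : Fin t) (hx : x ∉ Set.range xs) (hy : y ∉ Set.range ys)
    (hxyE : G.Adj (inl x) (inr y))
    (hdx : (k + 1) / 2 + 1 ≤
      {j : Fin k | G.Adj (inl x) (inr (ys j))}.ncard)
    (hdy : (k + 1) / 2 + 1 ≤
      {j : Fin k | G.Adj (inl (xs j)) (inr y)}.ncard) :
    HasCycleLen G (2 * k + 2) := by
  have hk0 : 0 < k := by omega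
  obtain ⟨j, hjx, hjy⟩ := exists_mem_inter_of_lt_ncard_add
    {j : Fin k | G.Adj (inl x) (inr (ys j))} {j : Fin k | G.Adj (inl (xs j)) (inr y)} (by omega)
  simp only [Set.mem_ofPred_eq] at hjx hjy
  refine hasCycleLen_of_alternating (by omega) _ _ (injOn_ite_mod hk0 xs hxs hx (j + 1))
    (injOn_ite_mod hk0 ys hys hy j) ?_ ?_ ?_
  · intro i hi
    by_cases h : i < k
    · have hmod : ((j + i) % k + 1) % k = (j + 1 + i) % k := by
        rw [Nat.mod_add_mod, Nat.add_right_comm]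
      simpa [h, hmod] using (hC ⟨(j + i) % k, Nat.mod_lt _ hk0⟩).2
    · simpa [h] using hxyE.symm
  · intro i hi
    by_cases h : i + 1 < k
    · have hidx : j + 1 + i = j + (i + 1) := by omega
      simpa [hi, h, hidx] using (hC ⟨(j + (i + 1)) % k, Nat.mod_lt _ hk0⟩).1
    · have hidx : (j + 1 + i) % k = j := by
        rw [show j + 1 + i = j + k by omega, Nat.add_mod_right, Nat.mod_eq_of_lt j.isLt]
      simpa [hi, h, hidx] using hjy
  · simpa [hk0, Nat.mod_eq_of_lt j.isLt] using hjx
end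

section
/- For every integer n ≥ 2, the bipartite Ramsey number BR(C_4, C_{2n}) equals 5 if n = 2 or n = 3, and equals n+1 if n ≥ 4. -/
open SimpleGraph Sum

/-- The bipartite relation `H` contains a cycle `x 0, y 0, x 1, y 1, …, x m, y m`. -/
def HasBiCycle {α β : Type*} (H : α → β → Prop) (m : ℕ) : Prop :=
  ∃ (x : Fin (m + 1) → α) (y : Fin (m + 1) → β), x.Injective ∧ y.Injective ∧
    ∀ i, H (x i) (y i) ∧ H (x (i + 1)) (y i)

theorem HasBiCycle.hasCycleLen {α β : Type*} {G : SimpleGraph (α ⊕ β)} {m : ℕ} (hm : 1 ≤ m)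
    (h : HasBiCycle (fun a b => G.Adj (inl a) (inr b)) m) : HasCycleLen G (2 * (m + 1)) := by
  obtain ⟨x, y, hx, hy, hxy⟩ := h
  refine (cycleGraph_isContained_iff (by omega)).1 ?_
  let f : Fin (2 * (m + 1)) → α ⊕ β := fun p =>
    if p.1 % 2 = 0 then inl (x ⟨p.1 / 2, by omega⟩) else inr (y ⟨p.1 / 2, by omega⟩)
  have hf : ∀ u v : Fin (2 * (m + 1)), (u - v).val = 1 → G.Adj (f u) (f v) := by
    intro u v huv
    have hu := u.2
    have hv := v.2
    have key : u.1 = v.1 + 1 ∨ (v.1 = 2 * m + 1 ∧ u.1 = 0) := by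
      rw [Fin.sub_def] at huv
      simp only at huv
      by_cases hle : v.1 ≤ u.1
      · rw [show 2 * (m + 1) - v.1 + u.1 = (u.1 - v.1) + 2 * (m + 1) by omega,
          Nat.add_mod_right, Nat.mod_eq_of_lt (by omega)] at huv
        omega
      · rw [Nat.mod_eq_of_lt (by omega)] at huv
        omega
    rcases key with h | ⟨h1, h2⟩
    · rcases Nat.mod_two_eq_zero_or_one v.1 with h0 | h0
      · have h1 : u.1 % 2 ≠ 0 := by omega
        simp only [f, if_pos h0, if_neg h1]
        have := (hxy ⟨v.1 / 2, by omega⟩).1.symm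
        convert this using 4
        omega
      · have h1 : u.1 % 2 = 0 := by omega
        simp only [f, if_pos h1, if_neg (show v.1 % 2 ≠ 0 by omega)]
        have := (hxy ⟨v.1 / 2, by omega⟩).2
        convert this using 3
        ext
        rw [Fin.val_add_one_of_lt (Fin.lt_def.2 (by simp only [Fin.val_last]; omega))]
        simp only
        omega
    · simp only [f, if_pos (show u.1 % 2 = 0 by omega), if_neg (show v.1 % 2 ≠ 0 by omega)]
      have := (hxy (Fin.last m)).2
      rw [Fin.last_add_one] at this
      convert this using 4
      · simp [h2]
      · simp only [Fin.val_last]; omega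
  refine ⟨⟨⟨f, fun {u v} huv => ?_⟩, fun u v huv => ?_⟩⟩
  · rcases cycleGraph_adj'.1 huv with h | h
    · exact hf _ _ h
    · exact (hf _ _ h).symm
  · have huv' : f u = f v := huv
    simp only [f] at huv'
    split_ifs at huv' with h1 h2 h2
    · have := hx (inl_injective huv')
      simp only [Fin.mk.injEq] at this
      ext; omega
    · have := hy (inr_injective huv')
      simp only [Fin.mk.injEq] at this
      ext; omega

theorem not_hasBiCycle_one_iff {α β : Type*} {G : α → β → Prop} :
    ¬ HasBiCycle G 1 ↔ ∀ a a' b b', a ≠ a' → G a b → G a b' → G a' b → G a' b' → b = b' := by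
  constructor
  · intro h a a' b b' ha h1 h2 h3 h4
    by_contra hb
    refine h ⟨![a, a'], ![b, b'], ?_, ?_, ?_⟩
    · intro i j; fin_cases i <;> fin_cases j <;> simp [ha, ha.symm]
    · intro i j; fin_cases i <;> fin_cases j <;> simp [hb, Ne.symm hb]
    · intro i; fin_cases i <;> simp [*]
  · rintro h ⟨x, y, hx, hy, hxy⟩
    have h0 := hxy 0
    have h1 := hxy 1
    have := hy (h (x 0) (x 1) (y 0) (y 1) (hx.ne (by decide)) h0.1 h1.2 h0.2 h1.1)
    exact absurd this (by decide)

theorem HasBiCycle.flip {α β : Type*} {H : α → β → Prop} {m : ℕ} (h : HasBiCycle H m) :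
    HasBiCycle (fun b a => H a b) m := by
  obtain ⟨x, y, hx, hy, hxy⟩ := h
  refine ⟨y, fun i => x (i + 1), hy, fun i j hij => ?_, fun i => ⟨(hxy i).2, (hxy (i + 1)).1⟩⟩
  exact add_right_cancel (hx hij)

theorem HasBiCycle.map {α β γ δ : Type*} {H : α → β → Prop} {f : γ → α} {g : δ → β} {m : ℕ}
    (h : HasBiCycle (fun c d => H (f c) (g d)) m) (hf : f.Injective) (hg : g.Injective) :
    HasBiCycle H m := by
  obtain ⟨x, y, hx, hy, hxy⟩ := h
  exact ⟨f ∘ x, g ∘ y, hf.comp hx, hg.comp hy, hxy⟩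

section Insertion

variable {α β : Type*} {H : α → β → Prop} {m : ℕ} {x : Fin (m + 1) → α} {y : Fin (m + 1) → β}
  {u : α} {v : β}

/-- A cycle can be extended by inserting the edge `u v` in place of the closing edge. -/
theorem HasBiCycle.insert_closing (hx : x.Injective) (hy : y.Injective)
    (hxy : ∀ i, H (x i) (y i) ∧ H (x (i + 1)) (y i)) (hu : u ∉ Set.range x)
    (hv : v ∉ Set.range y) (huv : H u v) (h0 : H (x 0) v) (h1 : H u (y (Fin.last m))) :
    HasBiCycle H (m + 1) := by
  refine ⟨Fin.snoc x u, Fin.snoc y v, Fin.snoc_injective_iff.2 ⟨hx, hu⟩,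
    Fin.snoc_injective_iff.2 ⟨hy, hv⟩, fun i => ?_⟩
  induction i using Fin.lastCases with
  | last =>
    rw [Fin.last_add_one, ← Fin.castSucc_zero]
    simp only [Fin.snoc_last, Fin.snoc_castSucc]
    exact ⟨huv, h0⟩
  | cast j =>
    rw [Fin.coeSucc_eq_succ]
    simp only [Fin.snoc_castSucc]
    refine ⟨(hxy j).1, ?_⟩
    induction j using Fin.lastCases with
    | last => simpa using h1
    | cast l =>
      have := (hxy l.castSucc).2
      rw [Fin.coeSucc_eq_succ] at this
      rw [Fin.succ_castSucc, Fin.snoc_castSucc]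
      exact this

theorem HasBiCycle.insert_after (hx : x.Injective) (hy : y.Injective)
    (hxy : ∀ i, H (x i) (y i) ∧ H (x (i + 1)) (y i)) (hu : u ∉ Set.range x)
    (hv : v ∉ Set.range y) (huv : H u v) (i : Fin (m + 1)) (h0 : H (x (i + 1)) v)
    (h1 : H u (y i)) : HasBiCycle H (m + 1) := by
  refine HasBiCycle.insert_closing (x := fun t => x (t + (i + 1))) (y := fun t => y (t + (i + 1)))
    (hx.comp (add_left_injective _)) (hy.comp (add_left_injective _)) (fun t => ?_)
    (fun ⟨t, ht⟩ => hu ⟨_, ht⟩) (fun ⟨t, ht⟩ => hv ⟨_, ht⟩) huv ?_ ?_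
  · refine ⟨(hxy _).1, ?_⟩
    rw [add_right_comm]
    exact (hxy _).2
  · simpa using h0
  · rw [add_comm i 1, ← add_assoc, Fin.last_add_one, zero_add]
    exact h1

theorem HasBiCycle.insert_before (hx : x.Injective) (hy : y.Injective)
    (hxy : ∀ i, H (x i) (y i) ∧ H (x (i + 1)) (y i)) (hu : u ∉ Set.range x)
    (hv : v ∉ Set.range y) (huv : H u v) (i : Fin (m + 1)) (h0 : H (x i) v)
    (h1 : H u (y i)) : HasBiCycle H (m + 1) := by
  refine HasBiCycle.insert_after (x := fun t => x (-t)) (y := fun t => y (-(t + 1)))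
    (hx.comp neg_injective) (hy.comp (neg_injective.comp (add_left_injective _))) (fun t => ?_)
    (fun ⟨t, ht⟩ => hu ⟨_, ht⟩) (fun ⟨t, ht⟩ => hv ⟨_, ht⟩) huv (-i - 1) ?_ ?_
  · refine ⟨?_, (hxy _).1⟩
    have := (hxy (-(t + 1))).2
    rwa [show -(t + 1) + 1 = -t by abel] at this
  · simpa using h0
  · simpa using h1

end Insertion

section Extension

variable {α β : Type*} {G : α → β → Prop} {m : ℕ}

open scoped Classical in
theorem hasBiCycle_compl_succ [Fintype α] [Fintype β] (hG : ¬ HasBiCycle G 1)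
    {x : Fin (m + 1) → α} {y : Fin (m + 1) → β} (hx : x.Injective) (hy : y.Injective)
    (hxy : ∀ i, ¬ G (x i) (y i) ∧ ¬ G (x (i + 1)) (y i)) {u u' : α} {v v' : β}
    (hu : u ∉ Set.range x) (hu' : u' ∉ Set.range x) (hv : v ∉ Set.range y)
    (hv' : v' ∉ Set.range y) (huu' : u ≠ u') (hvv' : v ≠ v') (huv : ¬ G u v)
    (hdu : ({b | G u b} : Finset β).card < m) (hdv : ({a | G a v} : Finset α).card < m)
    (hsum : ({b | G u b} : Finset β).card + ({a | G a v} : Finset α).card < m + 3) :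
    HasBiCycle (fun a b => ¬ G a b) (m + 1) := by
  by_contra hno
  have key : ∀ {p q}, p ∉ Set.range x → q ∉ Set.range y → ¬ G p q →
      ∀ i, G (x i) q ∨ G p (y i) := by
    intro p q hp hq hpq i
    by_contra! h
    exact hno (HasBiCycle.insert_before (H := fun a b => ¬ G a b) hx hy hxy hp hq hpq i h.1 h.2)
  have hrect := not_hasBiCycle_one_iff.1 hG
  have hcard : ∀ P : Fin (m + 1) → Prop,
      ({i | P i} : Finset (Fin (m + 1))).card + ({i | ¬ P i} : Finset (Fin (m + 1))).card
        = m + 1 := by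
    intro P
    rw [Finset.card_filter_add_card_filter_not, Finset.card_univ, Fintype.card_fin]
  have hS : ({i | G (x i) v} : Finset (Fin (m + 1))).card ≤ ({a | G a v} : Finset α).card :=
    Finset.card_le_card_of_injOn x (fun i hi => by simpa using hi) hx.injOn
  have hT : ({i | G u (y i)} : Finset (Fin (m + 1))).card ≤ ({b | G u b} : Finset β).card :=
    Finset.card_le_card_of_injOn y (fun i hi => by simpa using hi) hy.injOn
  by_cases h1 : G u' v
  swap
  · have : ({i | ¬ G (x i) v} : Finset (Fin (m + 1))).card ≤ 1 := by
      refine Finset.card_le_one.2 fun i hi j hj => ?_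
      simp only [Finset.mem_filter, Finset.mem_univ, true_and] at hi hj
      have a1 := (key hu hv huv i).resolve_left hi
      have a2 := (key hu hv huv j).resolve_left hj
      have a3 := (key hu' hv h1 i).resolve_left hi
      have a4 := (key hu' hv h1 j).resolve_left hj
      exact hy (hrect _ _ _ _ huu' a1 a2 a3 a4)
    have := hcard (fun i => G (x i) v)
    omega
  by_cases h2 : G u v'
  swap
  · have : ({i | ¬ G u (y i)} : Finset (Fin (m + 1))).card ≤ 1 := by
      refine Finset.card_le_one.2 fun i hi j hj => ?_
      simp only [Finset.mem_filter, Finset.mem_univ, true_and] at hi hj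
      have a1 := (key hu hv huv i).resolve_right hi
      have a2 := (key hu hv huv j).resolve_right hj
      have a3 := (key hu hv' h2 i).resolve_right hi
      have a4 := (key hu hv' h2 j).resolve_right hj
      by_contra hij
      exact hvv' (hrect _ _ _ _ (hx.ne hij) a1 a3 a2 a4)
    have := hcard (fun i => G u (y i))
    omega
  have hS' : ({i | G (x i) v} : Finset (Fin (m + 1))).card < ({a | G a v} : Finset α).card := by
    rw [← Finset.card_image_of_injective _ hx]
    refine Finset.card_lt_card (Finset.ssubset_iff_of_subset ?_ |>.2 ⟨u', by simpa using h1, ?_⟩)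
    · intro a ha
      simp only [Finset.mem_image, Finset.mem_filter, Finset.mem_univ, true_and] at ha ⊢
      obtain ⟨i, hi, rfl⟩ := ha
      exact hi
    · intro ha
      obtain ⟨i, -, hi⟩ := Finset.mem_image.1 ha
      exact hu' ⟨i, hi⟩
  have hT' : ({i | G u (y i)} : Finset (Fin (m + 1))).card < ({b | G u b} : Finset β).card := by
    rw [← Finset.card_image_of_injective _ hy]
    refine Finset.card_lt_card (Finset.ssubset_iff_of_subset ?_ |>.2 ⟨v', by simpa using h2, ?_⟩)
    · intro a ha
      simp only [Finset.mem_image, Finset.mem_filter, Finset.mem_univ, true_and] at ha ⊢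
      obtain ⟨i, hi, rfl⟩ := ha
      exact hi
    · intro ha
      obtain ⟨i, -, hi⟩ := Finset.mem_image.1 ha
      exact hv' ⟨i, hi⟩
  have hle : ({i | ¬ G (x i) v} : Finset (Fin (m + 1))).card
      ≤ ({i | G u (y i)} : Finset (Fin (m + 1))).card := by
    refine Finset.card_le_card fun i hi => ?_
    simp only [Finset.mem_filter, Finset.mem_univ, true_and] at hi ⊢
    exact (key hu hv huv i).resolve_left hi
  have := hcard (fun i => G (x i) v)
  omega

theorem Finset.card_add_card_add_card_le {ι : Type*} [DecidableEq ι] (A B C : Finset ι) :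
    A.card + B.card + C.card
      ≤ (A ∪ B ∪ C).card + (A ∩ B).card + (A ∩ C).card + (B ∩ C).card := by
  have h1 := Finset.card_union_add_card_inter A B
  have h2 := Finset.card_union_add_card_inter (A ∪ B) C
  have h3 : ((A ∪ B) ∩ C).card ≤ (A ∩ C).card + (B ∩ C).card := by
    rw [Finset.union_inter_distrib_right]
    exact Finset.card_union_le _ _
  omega

open scoped Classical in
theorem card_filter_and_le_one [Fintype β] (hG : ¬ HasBiCycle G 1) {a a' : α} (h : a ≠ a') :
    (({b | G a b} : Finset β) ∩ ({b | G a' b} : Finset β)).card ≤ 1 := by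
  refine Finset.card_le_one.2 fun b hb b' hb' => ?_
  simp only [Finset.mem_inter, Finset.mem_filter, Finset.mem_univ, true_and] at hb hb'
  exact not_hasBiCycle_one_iff.1 hG a a' b b' h hb.1 hb'.1 hb.2 hb'.2

open scoped Classical in
theorem exists_ne_degree_le [Fintype α] [Fintype β] (hG : ¬ HasBiCycle G 1) (hm : 3 ≤ m)
    (hα : Fintype.card α = m + 3) (hβ : Fintype.card β = m + 3) :
    ∃ a a', a ≠ a' ∧ ({b | G a b} : Finset β).card ≤ min (m - 1) ((m + 2) / 2) ∧
      ({b | G a' b} : Finset β).card ≤ min (m - 1) ((m + 2) / 2) := by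
  by_contra! hcon
  set N : α → Finset β := fun a => {b | G a b} with hN
  set D := min (m - 1) ((m + 2) / 2) with hD
  set S : Finset α := {a | (N a).card ≤ D} with hS
  set B : Finset α := {a | ¬ (N a).card ≤ D} with hB
  have hSB : S.card + B.card = m + 3 := by
    rw [hS, hB, Finset.card_filter_add_card_filter_not, Finset.card_univ, hα]
  have hS1 : S.card ≤ 1 := by
    refine Finset.card_le_one.2 fun a ha a' ha' => ?_
    simp only [hS, Finset.mem_filter, Finset.mem_univ, true_and] at ha ha'
    by_contra hne
    exact absurd ha' (not_le.2 (hcon a a' hne ha))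
  have hBdeg : ∀ a ∈ B, D + 1 ≤ (N a).card := by
    intro a ha
    simp only [hB, Finset.mem_filter, Finset.mem_univ, true_and] at ha
    omega
  have hint : ∀ a a', a ≠ a' → (N a ∩ N a').card ≤ 1 :=
    fun a a' h => card_filter_and_le_one hG h
  rcases hm.eq_or_lt with rfl | hm4
  · have hD2 : D = 2 := by rw [hD]; norm_num
    have htwo : ∀ b : β, (B.bipartiteBelow G b).card ≤ 2 := by
      intro b
      by_contra! h3
      obtain ⟨p, q, r, hp, hq, hr, hpq, hpr, hqr⟩ := Finset.two_lt_card_iff.1 h3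
      simp only [Finset.mem_bipartiteBelow] at hp hq hr
      have hmem : ∀ a, G a b → b ∈ N a := fun a h => by simpa [hN] using h
      have hdis : ∀ a a', a ≠ a' → G a b → G a' b →
          Disjoint ((N a).erase b) ((N a').erase b) := by
        intro a a' h ha ha'
        rw [Finset.disjoint_left]
        intro c hc hc'
        rw [Finset.mem_erase] at hc hc'
        exact hc.1 (Finset.card_le_one.1 (hint a a' h) c (Finset.mem_inter.2 ⟨hc.2, hc'.2⟩) b
          (Finset.mem_inter.2 ⟨hmem a ha, hmem a' ha'⟩))
      have hc : ∀ a ∈ B, G a b → 2 ≤ ((N a).erase b).card := by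
        intro a ha hab
        rw [Finset.card_erase_of_mem (hmem a hab)]
        have := hBdeg a ha
        omega
      have hU : (((N p).erase b ∪ (N q).erase b) ∪ (N r).erase b).card ≤ 5 := by
        have : (Finset.univ.erase b).card = 5 := by
          rw [Finset.card_erase_of_mem (Finset.mem_univ _), Finset.card_univ, hβ]
        rw [← this]
        refine Finset.card_le_card fun c hc => ?_
        simp only [Finset.mem_union, Finset.mem_erase] at hc ⊢
        simp only [Finset.mem_univ, and_true]
        tauto
      rw [Finset.card_union_of_disjoint (Finset.disjoint_union_left.2
        ⟨hdis p r hpr hp.2 hr.2, hdis q r hqr hq.2 hr.2⟩),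
        Finset.card_union_of_disjoint (hdis p q hpq hp.2 hq.2)] at hU
      have := hc p hp.1 hp.2
      have := hc q hq.1 hq.2
      have := hc r hr.1 hr.2
      omega
    have hdc := Finset.card_mul_le_card_mul (s := B) (t := Finset.univ) G (m := 3) (n := 2)
      (fun a ha => by
        have := hBdeg a ha
        simp only [Finset.bipartiteAbove]
        simp only [hN] at this
        omega) (fun b _ => htwo b)
    rw [Finset.card_univ, hβ] at hdc
    omega
  · obtain ⟨p, q, r, hp, hq, hr, hpq, hpr, hqr⟩ :=
      Finset.two_lt_card_iff.1 (show 2 < B.card by omega)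
    have h := Finset.card_add_card_add_card_le (N p) (N q) (N r)
    have hU := Finset.card_le_univ (N p ∪ N q ∪ N r)
    have := hint p q hpq
    have := hint p r hpr
    have := hint q r hqr
    have := hBdeg p hp
    have := hBdeg q hq
    have := hBdeg r hr
    omega

theorem hasBiCycle_compl_of_card (base : ∀ {α β : Type} [Fintype α] [Fintype β]
      {G : α → β → Prop}, ¬ HasBiCycle G 1 → Fintype.card α = 5 → Fintype.card β = 5 →
      HasBiCycle (fun a b => ¬ G a b) 3) {m : ℕ} (hm : 3 ≤ m) :
    ∀ {α β : Type} [Fintype α] [Fintype β] {G : α → β → Prop}, ¬ HasBiCycle G 1 →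
      Fintype.card α = m + 2 → Fintype.card β = m + 2 → HasBiCycle (fun a b => ¬ G a b) m := by
  induction m, hm using Nat.le_induction with
  | base => exact base
  | succ m hm ih =>
    intro α β _ _ G hG hα hβ
    classical
    have hG' : ¬ HasBiCycle (fun b a => G a b) 1 := fun h => hG h.flip
    obtain ⟨a, a', ha, hda, hda'⟩ := exists_ne_degree_le hG hm hα hβ
    obtain ⟨b, b', hb, hdb, hdb'⟩ := exists_ne_degree_le hG' hm hβ hα
    obtain ⟨u, v, huv, hdu, hdv⟩ : ∃ u v, ¬ G u v ∧
        ({b | G u b} : Finset β).card ≤ min (m - 1) ((m + 2) / 2) ∧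
        ({a | G a v} : Finset α).card ≤ min (m - 1) ((m + 2) / 2) := by
      by_contra! h
      refine hb (not_hasBiCycle_one_iff.1 hG a a' b b' ha ?_ ?_ ?_ ?_)
      · by_contra h'; exact absurd hdb (not_le.2 (h a b h' hda))
      · by_contra h'; exact absurd hdb' (not_le.2 (h a b' h' hda))
      · by_contra h'; exact absurd hdb (not_le.2 (h a' b h' hda'))
      · by_contra h'; exact absurd hdb' (not_le.2 (h a' b' h' hda'))
    have hsub := ih (α := {a // a ≠ u}) (β := {b // b ≠ v}) (G := fun a b => G a b)
      (fun h => hG (h.map Subtype.val_injective Subtype.val_injective))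
      (by simp [Fintype.card_subtype_compl, hα]) (by simp [Fintype.card_subtype_compl, hβ])
    obtain ⟨x, y, hx, hy, hxy⟩ := hsub
    have hout : ∀ {γ : Type} [Fintype γ] (w : γ) (z : Fin (m + 1) → {c // c ≠ w}),
        Fintype.card γ = m + 3 → ∃ w', w ≠ w' ∧ w' ∉ Set.range (fun i => (z i : γ)) := by
      intro γ _ w z hγ
      by_contra! h
      have hsub : (Finset.univ : Finset γ) ⊆
          insert w (Finset.univ.image fun i => (z i : γ)) := by
        intro c _
        rw [Finset.mem_insert]
        by_cases hc : w = c
        · exact Or.inl hc.symm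
        · obtain ⟨i, hi⟩ := h c hc
          exact Or.inr (Finset.mem_image.2 ⟨i, Finset.mem_univ _, hi⟩)
      have h1 := Finset.card_le_card hsub
      have h2 := Finset.card_insert_le w (Finset.univ.image fun i => (z i : γ))
      have h3 := Finset.card_image_le (s := Finset.univ) (f := fun i => (z i : γ))
      rw [Finset.card_univ, hγ] at h1
      rw [Finset.card_univ, Fintype.card_fin] at h3
      omega
    obtain ⟨u', hu', hu'x⟩ := hout u x hα
    obtain ⟨v', hv', hv'y⟩ := hout v y hβ
    refine hasBiCycle_compl_succ hG (x := fun i => (x i : α)) (y := fun i => (y i : β))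
      (Subtype.val_injective.comp hx) (Subtype.val_injective.comp hy) hxy ?_ hu'x ?_ hv'y hu' hv'
      huv ?_ ?_ ?_
    · rintro ⟨i, hi⟩; exact (x i).2 hi
    · rintro ⟨i, hi⟩; exact (y i).2 hi
    all_goals omega

end Extension

section FiveByFive

/-- A cyclic arrangement of `m + 1` rows and `m + 1` columns of a `5 × 5` array. -/
abbrev CellCycle (m : ℕ) : Type := (Fin (m + 1) → Fin 5) × (Fin (m + 1) → Fin 5)

/-- The position of a cell of a `5 × 5` array. -/
def cellIndex (i j : Fin 5) : ℕ := 5 * i + j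

/-- The set of cells visited by a cyclic arrangement, as a bit mask. -/
def CellCycle.mask {m : ℕ} (c : CellCycle m) : ℕ :=
  ((List.finRange (m + 1)).map fun t =>
    2 ^ cellIndex (c.1 t) (c.2 t) ||| 2 ^ cellIndex (c.1 (t + 1)) (c.2 t)).foldr (· ||| ·) 0

theorem CellCycle.testBit_mask {m : ℕ} (c : CellCycle m) (p : ℕ) :
    c.mask.testBit p = true ↔
      ∃ t, p = cellIndex (c.1 t) (c.2 t) ∨ p = cellIndex (c.1 (t + 1)) (c.2 t) := by
  have key : ∀ l : List (Fin (m + 1)), ((l.map fun t => 2 ^ cellIndex (c.1 t) (c.2 t) |||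
      2 ^ cellIndex (c.1 (t + 1)) (c.2 t)).foldr (· ||| ·) 0).testBit p = true ↔
      ∃ t ∈ l, p = cellIndex (c.1 t) (c.2 t) ∨ p = cellIndex (c.1 (t + 1)) (c.2 t) := by
    intro l
    induction l with
    | nil => simp
    | cons t l ih =>
      simp only [List.map_cons, List.foldr_cons, Nat.testBit_or, Bool.or_eq_true, ih,
        Nat.testBit_two_pow, decide_eq_true_eq, List.mem_cons, exists_eq_or_imp]
      simp only [eq_comm]
  rw [CellCycle.mask, key]
  simp

/-- Decides the cells in `order` one by one, with `h` the cells decided to belong to a relation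
and `g` those decided not to, until `h` contains a mask of `hs` or `g` contains a mask of `gs`. -/
def search (hs gs : List ℕ) : List ℕ → ℕ → ℕ → Bool
  | [], _, _ => false
  | p :: order, h, g =>
    (hs.any (fun c => Nat.beq (Nat.land c (Nat.lor h (2 ^ p))) c) ||
      search hs gs order (Nat.lor h (2 ^ p)) g) &&
    (gs.any (fun c => Nat.beq (Nat.land c (Nat.lor g (2 ^ p))) c) ||
      search hs gs order h (Nat.lor g (2 ^ p)))

theorem exists_mask_of_any {l : List ℕ} {h : ℕ} {P : ℕ → Prop}
    (hP : ∀ i, h.testBit i = true → P i)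
    (hl : l.any (fun c => Nat.beq (Nat.land c h) c) = true) :
    ∃ c ∈ l, ∀ i, c.testBit i = true → P i := by
  obtain ⟨c, hc, hch⟩ := List.any_eq_true.1 hl
  refine ⟨c, hc, fun i hi => hP i ?_⟩
  have : c &&& h = c := Nat.eq_of_beq_eq_true hch
  rw [← this, Nat.testBit_and, Bool.and_eq_true] at hi
  exact hi.2

theorem search_sound {hs gs : List ℕ} {P : ℕ → Prop} (order : List ℕ) {h g : ℕ}
    (hh : ∀ i, h.testBit i = true → P i) (hg : ∀ i, g.testBit i = true → ¬ P i)
    (hsearch : search hs gs order h g = true) :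
    (∃ c ∈ hs, ∀ i, c.testBit i = true → P i) ∨ ∃ c ∈ gs, ∀ i, c.testBit i = true → ¬ P i := by
  induction order generalizing h g with
  | nil => simp [search] at hsearch
  | cons p order ih =>
    rw [search, Bool.and_eq_true, Bool.or_eq_true, Bool.or_eq_true] at hsearch
    have step : ∀ {Q : ℕ → Prop} {k : ℕ}, (∀ i, k.testBit i = true → Q i) → Q p →
        ∀ i, (Nat.lor k (2 ^ p)).testBit i = true → Q i := by
      intro Q k hk hp i hi
      change (k ||| 2 ^ p).testBit i = true at hi
      rw [Nat.testBit_or, Nat.testBit_two_pow, Bool.or_eq_true, decide_eq_true_eq] at hi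
      rcases hi with hi | rfl
      · exact hk i hi
      · exact hp
    by_cases hp : P p
    · rcases hsearch.1 with h1 | h1
      · exact Or.inl (exists_mask_of_any (step hh hp) h1)
      · exact ih (step hh hp) hg h1
    · rcases hsearch.2 with h1 | h1
      · exact Or.inr (exists_mask_of_any (step (Q := fun i => ¬ P i) hg hp) h1)
      · exact ih hh (step (Q := fun i => ¬ P i) hg hp) h1

/-- Checks that the rows and the columns of a cyclic arrangement are distinct. -/
def CellCycle.isSimple {m : ℕ} (c : CellCycle m) : Bool :=
  (List.finRange (m + 1)).all fun i => (List.finRange (m + 1)).all fun j =>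
    Nat.beq i j || (!Nat.beq (c.1 i) (c.1 j) && !Nat.beq (c.2 i) (c.2 j))

theorem CellCycle.injective_of_isSimple {m : ℕ} {c : CellCycle m} (hc : c.isSimple = true) :
    c.1.Injective ∧ c.2.Injective := by
  have h : ∀ i j, i ≠ j → c.1 i ≠ c.1 j ∧ c.2 i ≠ c.2 j := by
    intro i j hij
    have := List.all_eq_true.1 (List.all_eq_true.1 hc i (List.mem_finRange i)) j
      (List.mem_finRange j)
    simpa [Nat.beq_eq_true_eq, Fin.val_inj, hij, Bool.eq_false_iff] using this
  exact ⟨fun i j hij => by_contra fun hne => (h i j hne).1 hij,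
    fun i j hij => by_contra fun hne => (h i j hne).2 hij⟩

theorem hasBiCycle_of_mask {G : Fin 5 → Fin 5 → Prop} {m : ℕ} {L : List (CellCycle m)}
    (hL : L.all CellCycle.isSimple = true) {P : ℕ → Prop}
    (hP : ∀ i j, P (cellIndex i j) → G i j)
    (h : ∃ c ∈ L.map CellCycle.mask, ∀ i, c.testBit i = true → P i) : HasBiCycle G m := by
  obtain ⟨k, hk, hkP⟩ := h
  obtain ⟨c, hc, rfl⟩ := List.mem_map.1 hk
  obtain ⟨hrow, hcol⟩ := CellCycle.injective_of_isSimple (List.all_eq_true.1 hL c hc)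
  exact ⟨c.1, c.2, hrow, hcol, fun i =>
    ⟨hP _ _ (hkP _ (c.testBit_mask _ |>.2 ⟨i, Or.inl rfl⟩)),
      hP _ _ (hkP _ (c.testBit_mask _ |>.2 ⟨i, Or.inr rfl⟩))⟩⟩

/-- The `2 × 2` subarrays. -/
def rectangles : List (CellCycle 1) :=
  let pairs : List (Fin 2 → Fin 5) := [![0, 1], ![0, 2], ![0, 3], ![0, 4], ![1, 2], ![1, 3],
    ![1, 4], ![2, 3], ![2, 4], ![3, 4]]
  pairs.flatMap fun a => pairs.map fun b => (a, b)

theorem isSimple_rectangles : rectangles.all CellCycle.isSimple = true := by decide +kernel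

theorem exists_perm_castLE {k : ℕ} (hk : k ≤ 5) {x : Fin k → Fin 5} (hx : x.Injective) :
    ∃ e : Equiv.Perm (Fin 5), ∀ i, e (Fin.castLE hk i) = x i := by
  classical
  let e := (Equiv.ofInjective _ (Fin.castLE_injective hk)).symm.trans (Equiv.ofInjective x hx)
  refine ⟨e.extendSubtype, fun i => ?_⟩
  rw [Equiv.extendSubtype_apply_of_mem e _ ⟨i, rfl⟩]
  have : (Equiv.ofInjective _ (Fin.castLE_injective hk)).symm ⟨Fin.castLE hk i, i, rfl⟩ = i :=
    Equiv.ofInjective_symm_apply _ i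
  simp only [e, Equiv.trans_apply]
  rw [this]
  rfl

theorem HasBiCycle.of_search {m k : ℕ} (hm : m + 1 ≤ 5) {L : List (CellCycle k)}
    (hL : L.all CellCycle.isSimple = true) (order : List ℕ)
    (hsearch : search (L.map CellCycle.mask) (rectangles.map CellCycle.mask) order
      (CellCycle.mask (m := m) (Fin.castLE hm, Fin.castLE hm)) 0 = true)
    {G : Fin 5 → Fin 5 → Prop} (hG : ¬ HasBiCycle G 1)
    (h : HasBiCycle (fun a b => ¬ G a b) m) : HasBiCycle (fun a b => ¬ G a b) k := by
  obtain ⟨x, y, hx, hy, hxy⟩ := h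
  obtain ⟨e, he⟩ := exists_perm_castLE hm hx
  obtain ⟨f, hf⟩ := exists_perm_castLE hm hy
  let P : ℕ → Prop := fun p => ∃ i j, p = cellIndex i j ∧ ¬ G (e i) (f j)
  have hP : ∀ i j, P (cellIndex i j) ↔ ¬ G (e i) (f j) := by
    refine fun i j => ⟨?_, fun h => ⟨i, j, rfl, h⟩⟩
    rintro ⟨i', j', hij, h⟩
    simp only [cellIndex] at hij
    obtain rfl : i = i' := by ext; omega
    obtain rfl : j = j' := by ext; omega
    exact h
  have hstart : ∀ p, (CellCycle.mask (m := m) (Fin.castLE hm, Fin.castLE hm)).testBit p = true →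
      P p := by
    intro p hp
    obtain ⟨t, rfl | rfl⟩ := (CellCycle.testBit_mask _ _).1 hp
    · rw [hP, he, hf]; exact (hxy t).1
    · rw [hP, he, hf]; exact (hxy t).2
  rcases search_sound order hstart (by simp) hsearch with h | h
  · exact (hasBiCycle_of_mask hL (fun i j => (hP i j).1) h).map e.injective f.injective
  · refine absurd (HasBiCycle.map (hasBiCycle_of_mask isSimple_rectangles
      (P := fun p => ¬ P p) (G := fun i j => G (e i) (f j)) ?_ h) e.injective f.injective) hG
    intro i j hij
    rwa [hP, not_not] at hij

/-- A selection of cycles of length 6 in the `5 × 5` array. -/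
def hexagons : List (CellCycle 2) :=
  [(![0, 1, 2], ![0, 1, 2]), (![0, 1, 2], ![0, 1, 3]), (![0, 1, 3], ![0, 1, 2]),
   (![0, 1, 3], ![0, 1, 3]), (![0, 1, 2], ![0, 1, 4]), (![0, 1, 3], ![0, 1, 4]),
   (![0, 1, 2], ![1, 2, 0]), (![0, 1, 2], ![1, 3, 0]), (![0, 1, 3], ![1, 2, 0]),
   (![0, 1, 2], ![0, 2, 1]), (![0, 1, 2], ![2, 0, 1]), (![0, 1, 3], ![1, 0, 2]),
   (![0, 1, 2], ![3, 0, 1]), (![0, 1, 3], ![2, 0, 1]), (![0, 1, 3], ![0, 2, 1]),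
   (![0, 1, 2], ![0, 2, 3]), (![0, 1, 2], ![0, 3, 1]), (![0, 1, 2], ![1, 0, 4]),
   (![0, 1, 3], ![3, 0, 1]), (![0, 1, 3], ![0, 2, 3]), (![0, 1, 2], ![0, 4, 1]),
   (![0, 1, 3], ![0, 4, 1]), (![0, 1, 3], ![1, 3, 0]), (![0, 1, 3], ![0, 3, 1]),
   (![0, 1, 3], ![1, 0, 4]), (![0, 1, 3], ![1, 0, 3]), (![0, 1, 3], ![0, 4, 2]),
   (![0, 1, 2], ![0, 3, 2]), (![0, 1, 2], ![0, 4, 2]), (![0, 1, 2], ![0, 4, 3]),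
   (![0, 1, 3], ![0, 3, 2]), (![0, 1, 3], ![0, 2, 4]), (![0, 1, 3], ![0, 3, 4]),
   (![0, 1, 3], ![0, 4, 3]), (![0, 1, 2], ![0, 2, 4]), (![0, 1, 2], ![0, 3, 4]),
   (![0, 2, 3], ![1, 3, 0]), (![0, 2, 3], ![1, 2, 0]), (![0, 2, 3], ![0, 4, 2]),
   (![0, 1, 2], ![1, 4, 0]), (![0, 1, 2], ![4, 0, 1]), (![0, 2, 3], ![0, 4, 3]),
   (![0, 2, 3], ![0, 3, 1]), (![0, 2, 3], ![0, 2, 1]), (![0, 2, 3], ![2, 4, 0]),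
   (![0, 2, 3], ![3, 4, 0]), (![0, 2, 3], ![0, 4, 1]), (![0, 1, 3], ![1, 4, 0]),
   (![0, 1, 3], ![4, 0, 1]), (![0, 2, 3], ![1, 4, 0]), (![0, 1, 2], ![1, 0, 3]),
   (![0, 2, 3], ![1, 3, 2]), (![0, 2, 3], ![0, 3, 4]), (![1, 2, 3], ![0, 4, 3]),
   (![0, 2, 3], ![1, 2, 3]), (![0, 2, 3], ![0, 2, 4]), (![1, 2, 3], ![0, 4, 2]),
   (![0, 2, 3], ![2, 4, 1]), (![1, 2, 3], ![3, 4, 0]), (![0, 2, 3], ![1, 4, 2]),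
   (![0, 2, 3], ![3, 4, 1]), (![1, 2, 3], ![2, 4, 0]), (![0, 2, 3], ![1, 4, 3]),
   (![1, 2, 3], ![0, 3, 2]), (![1, 2, 3], ![0, 2, 3]), (![0, 2, 3], ![2, 3, 1]),
   (![0, 2, 3], ![4, 3, 0]), (![0, 2, 3], ![3, 2, 1]), (![0, 2, 3], ![4, 2, 0]),
   (![0, 1, 2], ![1, 0, 2]), (![1, 2, 3], ![0, 3, 4]), (![1, 2, 3], ![0, 2, 4]),
   (![0, 2, 3], ![2, 3, 0]), (![1, 2, 3], ![4, 3, 0]), (![0, 2, 3], ![3, 2, 0]),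
   (![1, 2, 3], ![4, 2, 0]), (![1, 2, 3], ![2, 3, 0]), (![1, 2, 3], ![3, 2, 0]),
   (![1, 2, 3], ![2, 3, 1]), (![1, 2, 3], ![3, 2, 1]), (![1, 2, 3], ![1, 2, 3]),
   (![1, 2, 3], ![1, 4, 3]), (![1, 2, 3], ![2, 4, 1]), (![1, 2, 3], ![1, 3, 2]),
   (![1, 2, 3], ![3, 4, 1]), (![1, 2, 3], ![1, 4, 2])]

/-- A selection of cycles of length 8 in the `5 × 5` array. -/
def octagons : List (CellCycle 3) :=
  [(![0, 2, 1, 3], ![2, 1, 0, 3]), (![0, 1, 2, 3], ![0, 1, 2, 4]),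
   (![0, 2, 1, 3], ![2, 1, 0, 4]), (![0, 1, 2, 4], ![0, 1, 2, 4]),
   (![0, 2, 1, 4], ![2, 1, 0, 3]), (![0, 1, 2, 3], ![0, 1, 2, 3]),
   (![0, 2, 1, 4], ![2, 1, 0, 4]), (![0, 1, 2, 4], ![0, 1, 2, 3]),
   (![0, 1, 3, 2], ![0, 1, 3, 2]), (![0, 1, 3, 2], ![0, 1, 4, 2]),
   (![0, 1, 3, 2], ![0, 3, 1, 2]), (![0, 1, 4, 2], ![0, 3, 1, 2]),
   (![0, 1, 3, 2], ![0, 4, 1, 2]), (![0, 1, 3, 2], ![0, 1, 2, 4]),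
   (![0, 1, 4, 2], ![0, 4, 1, 2]), (![0, 1, 4, 2], ![0, 1, 3, 2]),
   (![0, 1, 2, 4], ![0, 1, 4, 2]), (![0, 1, 4, 2], ![0, 1, 2, 4]),
   (![0, 1, 3, 2], ![0, 1, 2, 3]), (![0, 1, 3, 4], ![0, 1, 3, 2]),
   (![0, 1, 4, 2], ![0, 1, 2, 3]), (![0, 1, 4, 2], ![0, 1, 4, 2]),
   (![0, 2, 1, 4], ![2, 1, 3, 0]), (![0, 1, 3, 4], ![0, 1, 4, 2]),
   (![0, 1, 2, 4], ![0, 1, 3, 2]), (![0, 2, 1, 4], ![2, 1, 4, 0]),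
   (![0, 1, 4, 2], ![3, 0, 1, 2]), (![0, 2, 1, 3], ![2, 1, 3, 0]),
   (![0, 2, 1, 3], ![2, 1, 4, 0]), (![0, 1, 4, 3], ![0, 1, 3, 2]),
   (![0, 2, 1, 3], ![3, 1, 0, 2]), (![0, 1, 4, 3], ![0, 1, 4, 2]),
   (![0, 1, 2, 4], ![0, 1, 3, 4]), (![0, 2, 1, 3], ![4, 1, 0, 2]),
   (![0, 1, 3, 4], ![0, 1, 3, 4]), (![0, 1, 2, 3], ![0, 1, 3, 4]),
   (![0, 2, 4, 3], ![2, 1, 4, 0]), (![0, 1, 3, 2], ![3, 0, 1, 2]),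
   (![0, 2, 4, 3], ![2, 1, 3, 0]), (![0, 1, 4, 3], ![0, 1, 3, 4]),
   (![0, 1, 2, 3], ![0, 3, 1, 2]), (![0, 1, 2, 4], ![0, 1, 4, 3]),
   (![0, 1, 2, 3], ![4, 1, 2, 0]), (![0, 1, 2, 3], ![0, 4, 1, 2]),
   (![0, 1, 3, 4], ![0, 1, 4, 3]), (![0, 1, 2, 3], ![3, 1, 2, 0]),
   (![0, 1, 2, 3], ![0, 1, 4, 3]), (![0, 1, 2, 4], ![0, 3, 1, 2]),
   (![0, 2, 1, 4], ![3, 1, 0, 2]), (![0, 1, 2, 4], ![4, 1, 2, 0]),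
   (![0, 1, 2, 4], ![0, 4, 1, 2]), (![0, 2, 1, 4], ![4, 1, 0, 2]),
   (![0, 2, 3, 4], ![2, 1, 4, 0]), (![0, 1, 4, 2], ![2, 0, 1, 3]),
   (![0, 2, 3, 4], ![2, 1, 3, 0]), (![0, 1, 4, 2], ![4, 0, 1, 2]),
   (![0, 1, 4, 3], ![0, 1, 4, 3]), (![0, 1, 3, 2], ![2, 0, 1, 3]),
   (![0, 1, 3, 2], ![4, 0, 1, 2]), (![0, 2, 4, 3], ![2, 3, 4, 0]),
   (![0, 3, 1, 4], ![2, 0, 1, 4]), (![0, 2, 4, 3], ![2, 4, 3, 0]),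
   (![0, 3, 1, 4], ![2, 0, 1, 3]), (![0, 3, 2, 4], ![0, 3, 1, 2]),
   (![0, 3, 1, 4], ![4, 1, 0, 2]), (![0, 3, 1, 4], ![3, 1, 0, 2]),
   (![0, 3, 2, 4], ![0, 4, 1, 2]), (![0, 1, 2, 3], ![0, 1, 4, 2]),
   (![0, 1, 4, 2], ![2, 0, 1, 4]), (![0, 2, 3, 4], ![2, 3, 4, 0]),
   (![0, 2, 3, 4], ![2, 4, 3, 0]), (![0, 3, 2, 4], ![2, 1, 3, 0]),
   (![0, 3, 2, 4], ![2, 1, 4, 0]), (![0, 1, 2, 4], ![3, 1, 2, 0]),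
   (![0, 1, 2, 3], ![0, 1, 3, 2]), (![1, 3, 2, 4], ![4, 2, 3, 0]),
   (![0, 1, 2, 3], ![1, 3, 2, 0]), (![1, 3, 2, 4], ![3, 2, 4, 0]),
   (![0, 1, 2, 3], ![1, 4, 2, 0]), (![0, 3, 1, 4], ![2, 3, 1, 4]),
   (![0, 1, 2, 3], ![4, 0, 1, 2]), (![0, 3, 1, 4], ![2, 4, 1, 3]),
   (![0, 1, 2, 3], ![3, 0, 1, 2]), (![0, 1, 2, 4], ![1, 3, 2, 0]),
   (![1, 3, 2, 4], ![0, 3, 2, 4]), (![0, 3, 2, 4], ![0, 3, 1, 4]),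
   (![0, 2, 1, 4], ![2, 3, 1, 0]), (![0, 3, 2, 4], ![4, 1, 3, 0]),
   (![0, 2, 1, 3], ![2, 3, 1, 0]), (![1, 2, 4, 3], ![1, 2, 3, 0]),
   (![0, 1, 3, 2], ![0, 3, 4, 2]), (![0, 3, 2, 4], ![3, 1, 4, 0]),
   (![0, 1, 3, 2], ![2, 0, 1, 4]), (![0, 2, 1, 3], ![2, 4, 1, 0]),
   (![0, 1, 2, 4], ![3, 0, 1, 2]), (![0, 3, 1, 4], ![3, 1, 4, 2]),
   (![0, 1, 2, 4], ![1, 4, 2, 0]), (![1, 3, 2, 4], ![0, 4, 2, 3]),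
   (![0, 3, 2, 4], ![0, 4, 1, 3]), (![0, 2, 1, 4], ![2, 4, 1, 0]),
   (![0, 1, 2, 4], ![4, 0, 1, 2]), (![0, 3, 1, 4], ![4, 1, 3, 2]),
   (![0, 1, 4, 2], ![0, 3, 2, 4]), (![0, 1, 4, 2], ![0, 3, 4, 2])]

theorem isSimple_hexagons : hexagons.all CellCycle.isSimple = true := by decide +kernel

theorem isSimple_octagons : octagons.all CellCycle.isSimple = true := by decide +kernel

set_option maxRecDepth 10000 in
theorem search_hexagons :
    search (hexagons.map CellCycle.mask) (rectangles.map CellCycle.mask)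
      [10, 2, 12, 3, 13, 15, 18, 17, 8, 7, 16, 11, 19, 14, 4, 9, 24, 21, 22, 20, 23]
      (CellCycle.mask (m := 1) (Fin.castLE (by decide), Fin.castLE (by decide))) 0 = true := by
  decide +kernel

set_option maxRecDepth 10000 in
theorem search_octagons :
    search (octagons.map CellCycle.mask) (rectangles.map CellCycle.mask)
      [17, 13, 18, 19, 14, 23, 22, 24, 21, 16, 3, 4, 20, 15, 9, 8, 1, 7, 10]
      (CellCycle.mask (m := 2) (Fin.castLE (by decide), Fin.castLE (by decide))) 0 = true := by
  decide +kernel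

theorem HasBiCycle.compl_two_of_one {G : Fin 5 → Fin 5 → Prop} (hG : ¬ HasBiCycle G 1)
    (h : HasBiCycle (fun a b => ¬ G a b) 1) : HasBiCycle (fun a b => ¬ G a b) 2 :=
  HasBiCycle.of_search (m := 1) (k := 2) (by decide) isSimple_hexagons _
    search_hexagons hG h

theorem HasBiCycle.compl_three_of_two {G : Fin 5 → Fin 5 → Prop} (hG : ¬ HasBiCycle G 1)
    (h : HasBiCycle (fun a b => ¬ G a b) 2) : HasBiCycle (fun a b => ¬ G a b) 3 :=
  HasBiCycle.of_search (m := 2) (k := 3) (by decide) isSimple_octagons _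
    search_octagons hG h

theorem hasBiCycle_one_of_row {R : Fin 5 → Fin 5 → Prop} (hR : ¬ HasBiCycle R 1) {a : Fin 5}
    {b : Fin 3 → Fin 5} (hb : b.Injective) (hab : ∀ j, R a (b j)) :
    HasBiCycle (fun a b => ¬ R a b) 1 := by
  by_contra hcon
  have hrect := not_hasBiCycle_one_iff.1 hR
  have hrect' := not_hasBiCycle_one_iff.1 hcon
  have haux : ∀ t : Fin 3, t ≠ t + 1 ∧ t ≠ t + 2 ∧ t + 1 ≠ t + 2 := by decide
  have hex : ∀ r : {r // r ≠ a}, ∃ t : Fin 3, ¬ R r (b (t + 1)) ∧ ¬ R r (b (t + 2)) := by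
    intro ⟨r, hr⟩
    have h : ∀ i j, R r (b i) → R r (b j) → i = j := fun i j hi hj =>
      hb (hrect a r (b i) (b j) (Ne.symm hr) (hab i) (hab j) hi hj)
    by_cases h0 : ∃ t, R r (b t)
    · obtain ⟨t, ht⟩ := h0
      refine ⟨t, fun h' => ?_, fun h' => ?_⟩
      · exact (haux t).1 (h _ _ ht h')
      · exact (haux t).2.1 (h _ _ ht h')
    · push Not at h0
      exact ⟨0, h0 _, h0 _⟩
  choose f hf using hex
  obtain ⟨r, r', hrr, hfr⟩ := Fintype.exists_ne_map_eq_of_card_lt f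
    (by simp [Fintype.card_subtype_compl])
  have h1 := hf r
  have h2 := hf r'
  rw [← hfr] at h2
  exact (haux (f r)).2.2
    (hb (hrect' r r' _ _ (fun h => hrr (Subtype.ext h)) h1.1 h1.2 h2.1 h2.2))

theorem hasBiCycle_compl_one {G : Fin 5 → Fin 5 → Prop} (hG : ¬ HasBiCycle G 1) :
    HasBiCycle (fun a b => ¬ G a b) 1 := by
  classical
  by_contra hcon
  have hthree : ∀ R : Fin 5 → Fin 5 → Prop, 3 ≤ ({b | R 0 b} : Finset (Fin 5)).card →
      ∃ b : Fin 3 → Fin 5, b.Injective ∧ ∀ j, R 0 (b j) := by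
    intro R h
    obtain ⟨p, q, r, hp, hq, hr, hpq, hpr, hqr⟩ := Finset.two_lt_card_iff.1 h
    simp only [Finset.mem_filter, Finset.mem_univ, true_and] at hp hq hr
    refine ⟨![p, q, r], fun i j => ?_, fun j => ?_⟩
    · fin_cases i <;> fin_cases j <;> simp [*, Ne.symm hpq, Ne.symm hpr, Ne.symm hqr]
    · fin_cases j <;> simp [*]
  have hsum : ({b | G 0 b} : Finset (Fin 5)).card + ({b | ¬ G 0 b} : Finset (Fin 5)).card = 5 := by
    rw [Finset.card_filter_add_card_filter_not, Finset.card_univ, Fintype.card_fin]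
  by_cases h3 : 3 ≤ ({b | G 0 b} : Finset (Fin 5)).card
  · obtain ⟨b, hb, hGb⟩ := hthree G h3
    exact hcon (hasBiCycle_one_of_row hG hb hGb)
  · obtain ⟨b, hb, hGb⟩ := hthree (fun a b => ¬ G a b) (by
      rw [not_le] at h3
      convert (show 3 ≤ ({b | ¬ G 0 b} : Finset (Fin 5)).card by omega))
    have := hasBiCycle_one_of_row hcon hb hGb
    simp only [not_not] at this
    exact hG this

end FiveByFive

section LowerBound

theorem HasCycleLen.map {V W : Type*} {G : SimpleGraph V} {G' : SimpleGraph W} {m : ℕ}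
    (f : G →g G') (hf : Function.Injective f) (h : HasCycleLen G m) : HasCycleLen G' m := by
  obtain ⟨v, w, hw, hm⟩ := h
  exact ⟨f v, w.map f, (Walk.isCycle_map_iff_of_injective hf).2 hw, by rw [Walk.length_map, hm]⟩

theorem BRprop.mono {m n b c : ℕ} (hbc : b ≤ c) (h : BRprop m n b) : BRprop m n c := by
  intro G hG
  let e : Fin b ⊕ Fin b → Fin c ⊕ Fin c := Sum.map (Fin.castLE hbc) (Fin.castLE hbc)
  have he : e.Injective :=
    (Fin.castLE_injective hbc).sumMap (Fin.castLE_injective hbc)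
  have hK : ∀ p q, (Kbb c).Adj (e p) (e q) ↔ (Kbb b).Adj p q := by
    rintro (p | p) (q | q) <;> simp [e]
  rcases h (G.comap e) (fun p q hpq => (hK p q).1 (hG hpq)) with h | h
  · exact Or.inl (h.map ⟨e, fun hpq => hpq⟩ he)
  · refine Or.inr (h.map ⟨e, fun {p q} hpq => ?_⟩ he)
    rw [sdiff_adj] at hpq ⊢
    exact ⟨(hK p q).2 hpq.1, hpq.2⟩

/-- The star joining the first vertex on the left to every vertex on the right does not force a
Hamiltonian cycle in its complement. -/
theorem not_BRprop_self {n : ℕ} (hn : 2 ≤ n) : ¬ BRprop 4 (2 * n) n := by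
  intro h
  have : NeZero n := ⟨by omega⟩
  let c : Fin n ⊕ Fin n := inl 0
  let S : SimpleGraph (Fin n ⊕ Fin n) :=
    { Adj := fun p q => (Kbb n).Adj p q ∧ (p = c ∨ q = c)
      symm := ⟨fun p q h => ⟨h.1.symm, h.2.symm⟩⟩
      loopless := ⟨fun p h => (Kbb n).loopless.irrefl p h.1⟩ }
  rcases h S (fun p q h => h.1) with h | h
  · obtain ⟨f⟩ := (cycleGraph_isContained_iff (by norm_num)).2 h
    have h01 : S.Adj (f 0) (f 1) := f.toHom.map_adj (by decide)
    have h23 : S.Adj (f 2) (f 3) := f.toHom.map_adj (by decide)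
    have hne : ∀ {i j}, f i = c → f j = c → i = j := fun hi hj => f.injective (hi.trans hj.symm)
    rcases h01.2 with h1 | h1 <;> rcases h23.2 with h2 | h2 <;>
      exact absurd (hne h1 h2) (by decide)
  · obtain ⟨f⟩ := (cycleGraph_isContained_iff (by omega)).2 h
    have hsurj : Function.Surjective f :=
      ((Fintype.bijective_iff_injective_and_card f).2
        ⟨f.injective, by simp [two_mul]⟩).2
    obtain ⟨i, hi⟩ := hsurj c
    obtain ⟨j, hj⟩ : ∃ j, (cycleGraph (2 * n)).Adj i j := by
      have : Nontrivial (Fin (2 * n)) := Fin.nontrivial_iff_two_le.2 (by omega)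
      exact cycleGraph_preconnected.exists_adj_of_nontrivial i
    have := f.toHom.map_adj hj
    change (Kbb n \ S).Adj (f i) (f j) at this
    rw [sdiff_adj, hi] at this
    exact this.2 ⟨this.1, Or.inl rfl⟩

/-- Adjacency in an octagon of `K_{4,4}`; its bipartite complement is given by `s = 2`. -/
def octagonAdj (s : Fin 4) : Fin 4 ⊕ Fin 4 → Fin 4 ⊕ Fin 4 → Bool
  | inl i, inr j => j == i + s || j == i + s + 1
  | inr j, inl i => j == i + s || j == i + s + 1
  | _, _ => false

theorem not_BRprop_four {n : ℕ} (hn : n = 2 ∨ n = 3) : ¬ BRprop 4 (2 * n) 4 := by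
  intro h
  let G : SimpleGraph (Fin 4 ⊕ Fin 4) :=
    { Adj := fun p q => octagonAdj 0 p q = true
      symm := ⟨by decide⟩
      loopless := ⟨by decide⟩ }
  have four : ∀ s : Fin 4, ∀ a b, octagonAdj s a b = true → ∀ c, octagonAdj s b c = true → c ≠ a →
      ∀ d, octagonAdj s c d = true → d ≠ b → ¬ octagonAdj s d a = true := by decide +kernel
  have six : ∀ s : Fin 4, ∀ a b, octagonAdj s a b = true → ∀ c, octagonAdj s b c = true → c ≠ a →
      ∀ d, octagonAdj s c d = true → d ≠ b → ∀ e, octagonAdj s d e = true → e ≠ c →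
      ∀ f, octagonAdj s e f = true → f ≠ d → ¬ octagonAdj s f a = true := by decide +kernel
  have not_four : ∀ (H : SimpleGraph (Fin 4 ⊕ Fin 4)) (s : Fin 4),
      (∀ p q, H.Adj p q → octagonAdj s p q = true) → ¬ HasCycleLen H 4 := by
    intro H s hH h
    obtain ⟨f⟩ := (cycleGraph_isContained_iff (by norm_num)).2 h
    have hf : ∀ i j, (cycleGraph 4).Adj i j → octagonAdj s (f i) (f j) = true :=
      fun i j hij => hH _ _ (f.toHom.map_adj hij)
    exact four s (f 0) (f 1) (hf _ _ (by decide)) (f 2) (hf _ _ (by decide))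
      (f.injective.ne (by decide)) (f 3) (hf _ _ (by decide)) (f.injective.ne (by decide))
      (hf _ _ (by decide))
  have not_six : ∀ (H : SimpleGraph (Fin 4 ⊕ Fin 4)) (s : Fin 4),
      (∀ p q, H.Adj p q → octagonAdj s p q = true) → ¬ HasCycleLen H 6 := by
    intro H s hH h
    obtain ⟨f⟩ := (cycleGraph_isContained_iff (by norm_num)).2 h
    have hf : ∀ i j, (cycleGraph 6).Adj i j → octagonAdj s (f i) (f j) = true :=
      fun i j hij => hH _ _ (f.toHom.map_adj hij)
    exact six s (f 0) (f 1) (hf _ _ (by decide)) (f 2) (hf _ _ (by decide))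
      (f.injective.ne (by decide)) (f 3) (hf _ _ (by decide)) (f.injective.ne (by decide))
      (f 4) (hf _ _ (by decide)) (f.injective.ne (by decide))
      (f 5) (hf _ _ (by decide)) (f.injective.ne (by decide)) (hf _ _ (by decide))
  have hsub : ∀ p q, ((p.isLeft ∧ q.isRight ∨ p.isRight ∧ q.isLeft) ∧ ¬ octagonAdj 0 p q = true) →
      octagonAdj 2 p q = true := by decide +kernel
  have hK : ∀ p q, octagonAdj 0 p q = true →
      (p.isLeft ∧ q.isRight ∨ p.isRight ∧ q.isLeft) := by decide +kernel
  rcases h G (fun p q hpq => hK p q hpq) with h | h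
  · exact not_four G 0 (fun _ _ h => h) h
  · have hc : ∀ p q, (Kbb 4 \ G).Adj p q → octagonAdj 2 p q = true := fun p q hpq =>
      hsub p q ((sdiff_adj _ _ _ _).1 hpq)
    rcases hn with rfl | rfl
    · exact not_four _ 2 hc h
    · exact not_six _ 2 hc h

end LowerBound

theorem BRprop_succ_of_hasBiCycle {m b : ℕ} (hm : 1 ≤ m)
    (h : ∀ G : Fin b → Fin b → Prop, ¬ HasBiCycle G 1 → HasBiCycle (fun i j => ¬ G i j) m) :
    BRprop 4 (2 * (m + 1)) b := by
  intro G _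
  by_cases hG : HasBiCycle (fun i j => G.Adj (inl i) (inr j)) 1
  · exact Or.inl (hG.hasCycleLen le_rfl)
  · refine Or.inr (HasBiCycle.hasCycleLen hm ?_)
    simpa [sdiff_adj] using h _ hG

theorem hasBiCycle_compl_three {α β : Type} [Fintype α] [Fintype β] {G : α → β → Prop}
    (hG : ¬ HasBiCycle G 1) (hα : Fintype.card α = 5) (hβ : Fintype.card β = 5) :
    HasBiCycle (fun a b => ¬ G a b) 3 := by
  let e := (Fintype.equivFinOfCardEq hα).symm
  let f := (Fintype.equivFinOfCardEq hβ).symm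
  have hG' : ¬ HasBiCycle (fun i j => G (e i) (f j)) 1 :=
    fun h => hG (h.map e.injective f.injective)
  exact ((((hasBiCycle_compl_one hG').compl_two_of_one hG').compl_three_of_two hG')).map
    e.injective f.injective

/-- Theorem (Zhang et al.): for `n ≥ 2`, `BR(C_4, C_{2n}) = 5` if `n = 2, 3` and
`n + 1` otherwise. -/
theorem stmt6 (n : ℕ) (hn : 2 ≤ n) :
    IsLeast {b : ℕ | 0 < b ∧ BRprop 4 (2 * n) b}
      (if n = 2 ∨ n = 3 then 5 else n + 1) := by
  split_ifs with h
  · refine ⟨⟨by norm_num, ?_⟩, fun b hb => ?_⟩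
    · rcases h with rfl | rfl
      · exact BRprop_succ_of_hasBiCycle (m := 1) le_rfl fun G hG => hasBiCycle_compl_one hG
      · exact BRprop_succ_of_hasBiCycle (m := 2) (by norm_num)
          fun G hG => (hasBiCycle_compl_one hG).compl_two_of_one hG
    · by_contra hlt
      exact not_BRprop_four h (hb.2.mono (by omega))
  · refine ⟨⟨by omega, ?_⟩, fun b hb => ?_⟩
    · obtain ⟨m, rfl⟩ : ∃ m, n = m + 1 := ⟨n - 1, by omega⟩
      exact BRprop_succ_of_hasBiCycle (by omega) fun G hG =>
        hasBiCycle_compl_of_card hasBiCycle_compl_three (by omega) hG (by simp) (by simp)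
    · by_contra hlt
      exact not_BRprop_self hn (hb.2.mono (by omega))
end
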